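/- Fix an integer d ≥ 1. There exists a constant C(d) > 0 depending only on d such that for every n ≥ 1, every f : {-1,1}^n → [-1,1] of degree at most d, and every ε > 0, there exists a k-junta g : {-1,1}^n → ℝ with ‖f − g‖_2 ≤ ε and k ≤ d · C(d)^{2d} / ε^{2d}. -/

import Mathlib

open Finset

section WalshFunctions

variable {ι : Type*}

/-- The Walsh function `χ_S` on the cube, with `true` and `false` read as `1` and `-1`. -/
def walsh (S : Finset ι) (x : ι → Bool) : ℝ := ∏ j ∈ S, (if x j then (1 : ℝ) else -1)

variable [DecidableEq ι]

/-- The value of a Walsh function does not depend on coordinates outside its index set. -/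
theorem walsh_update_of_notMem {S : Finset ι} {a : ι} (ha : a ∉ S) (x : ι → Bool) (b : Bool) :
    walsh S (Function.update x a b) = walsh S x := by
  refine prod_congr rfl fun j hj => ?_
  have hja : j ≠ a := fun h => ha (h ▸ hj)
  rw [Function.update_of_ne hja]

/-- Splitting a Walsh polynomial according to whether a coordinate `a` occurs. -/
theorem sum_powerset_insert_walsh {A : Finset ι} {a : ι} (ha : a ∉ A) (c : Finset ι → ℝ)
    (x : ι → Bool) :
    ∑ S ∈ (insert a A).powerset, c S * walsh S x =
      ∑ S ∈ A.powerset, c S * walsh S x +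
        (if x a then (1 : ℝ) else -1) * ∑ S ∈ A.powerset, c (insert a S) * walsh S x := by
  rw [sum_powerset_insert ha, mul_sum]
  congr 1
  refine sum_congr rfl fun S hS => ?_
  have haS : a ∉ S := fun h => ha (mem_powerset.mp hS h)
  rw [walsh, prod_insert haS, walsh]
  ring

theorem sum_walsh_update_of_notMem {A : Finset ι} {a : ι} (ha : a ∉ A) (c : Finset ι → ℝ)
    (x : ι → Bool) (b : Bool) :
    ∑ S ∈ A.powerset, c S * walsh S (Function.update x a b) =
      ∑ S ∈ A.powerset, c S * walsh S x :=
  sum_congr rfl fun S hS => by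
    rw [walsh_update_of_notMem (fun h => ha (mem_powerset.mp hS h))]

variable [Fintype ι]

/-- A function not depending on coordinate `a` has vanishing correlation with that coordinate. -/
theorem sum_sign_mul_eq_zero (a : ι) (F : (ι → Bool) → ℝ)
    (hF : ∀ x b, F (Function.update x a b) = F x) :
    ∑ x, (if x a then (1 : ℝ) else -1) * F x = 0 := by
  have hinv : Function.Involutive fun x : ι → Bool => Function.update x a (!x a) := by
    intro x
    simp
  have h := Equiv.sum_comp hinv.toPerm fun x : ι → Bool => (if x a then (1 : ℝ) else -1) * F x
  have h' : ∀ x : ι → Bool,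
      (if Function.update x a (!x a) a then (1 : ℝ) else -1) * F (Function.update x a (!x a)) =
        -((if x a then (1 : ℝ) else -1) * F x) := by
    intro x
    rw [hF, Function.update_self]
    cases x a <;> simp
  have h2 := h.symm.trans ((sum_congr rfl fun x _ => h' x).trans (sum_neg_distrib _))
  linarith

theorem sum_add_sign_mul_sq (a : ι) (h k : (ι → Bool) → ℝ)
    (hh : ∀ x b, h (Function.update x a b) = h x) (hk : ∀ x b, k (Function.update x a b) = k x) :
    ∑ x, (h x + (if x a then (1 : ℝ) else -1) * k x) ^ 2 = ∑ x, h x ^ 2 + ∑ x, k x ^ 2 := by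
  have h0 := sum_sign_mul_eq_zero a (fun x => 2 * h x * k x) (fun x b => by simp only [hh, hk])
  rw [← sum_add_distrib, ← add_zero (∑ x, (h x ^ 2 + k x ^ 2)), ← h0, ← sum_add_distrib]
  refine sum_congr rfl fun x _ => ?_
  split_ifs <;> ring

theorem sum_add_sign_mul_pow_four (a : ι) (h k : (ι → Bool) → ℝ)
    (hh : ∀ x b, h (Function.update x a b) = h x) (hk : ∀ x b, k (Function.update x a b) = k x) :
    ∑ x, (h x + (if x a then (1 : ℝ) else -1) * k x) ^ 4 =
      ∑ x, h x ^ 4 + 6 * ∑ x, h x ^ 2 * k x ^ 2 + ∑ x, k x ^ 4 := by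
  have h0 := sum_sign_mul_eq_zero a (fun x => 4 * h x ^ 3 * k x + 4 * h x * k x ^ 3)
    (fun x b => by simp only [hh, hk])
  rw [mul_sum, ← sum_add_distrib, ← sum_add_distrib,
    ← add_zero (∑ x, (h x ^ 4 + 6 * (h x ^ 2 * k x ^ 2) + k x ^ 4)), ← h0, ← sum_add_distrib]
  refine sum_congr rfl fun x _ => ?_
  split_ifs <;> ring

/-- Parseval's identity for Walsh polynomials on the coordinates in `A`. -/
theorem sum_walsh_sq (A : Finset ι) (c : Finset ι → ℝ) :
    ∑ x : ι → Bool, (∑ S ∈ A.powerset, c S * walsh S x) ^ 2 =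
      2 ^ Fintype.card ι * ∑ S ∈ A.powerset, c S ^ 2 := by
  induction A using Finset.induction_on generalizing c with
  | empty => simp [walsh]
  | insert a A ha ih =>
    simp only [sum_powerset_insert_walsh ha]
    rw [sum_add_sign_mul_sq a _ _ (sum_walsh_update_of_notMem ha c)
      (sum_walsh_update_of_notMem ha fun S => c (insert a S)), ih c, ih fun S => c (insert a S),
      sum_powerset_insert ha, mul_add]

/-- Bonami's lemma: the fourth moment of a Walsh polynomial of degree at most `d` is at most
`9 ^ d` times the square of its second moment. -/
theorem bonami (A : Finset ι) (d : ℕ) (c : Finset ι → ℝ) (hc : ∀ S, d < S.card → c S = 0) :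
    2 ^ Fintype.card ι * ∑ x : ι → Bool, (∑ S ∈ A.powerset, c S * walsh S x) ^ 4 ≤
      9 ^ d * (∑ x : ι → Bool, (∑ S ∈ A.powerset, c S * walsh S x) ^ 2) ^ 2 := by
  induction A using Finset.induction_on generalizing c d with
  | empty =>
    have h9 : (1 : ℝ) ≤ 9 ^ d := one_le_pow₀ (by norm_num)
    simp only [powerset_empty, sum_singleton, walsh, prod_empty, mul_one, sum_const, card_univ,
      Fintype.card_bool, nsmul_eq_mul, Fintype.card_fun]
    push_cast
    have h0 : (0 : ℝ) ≤ (2 ^ Fintype.card ι * c ∅ ^ 2) ^ 2 := by positivity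
    nlinarith
  | insert a A ha ih =>
    simp only [sum_powerset_insert_walsh ha]
    rw [sum_add_sign_mul_sq a _ _ (sum_walsh_update_of_notMem ha c)
      (sum_walsh_update_of_notMem ha fun S => c (insert a S)),
      sum_add_sign_mul_pow_four a _ _ (sum_walsh_update_of_notMem ha c)
      (sum_walsh_update_of_notMem ha fun S => c (insert a S))]
    have hh := ih d c hc
    have hcs := sum_mul_sq_le_sq_mul_sq (univ : Finset (ι → Bool))
      (fun x => (∑ S ∈ A.powerset, c S * walsh S x) ^ 2)
      (fun x => (∑ S ∈ A.powerset, c (insert a S) * walsh S x) ^ 2)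
    have hk : 9 * (2 ^ Fintype.card ι *
        ∑ x : ι → Bool, (∑ S ∈ A.powerset, c (insert a S) * walsh S x) ^ 4) ≤
        9 ^ d * (∑ x : ι → Bool, (∑ S ∈ A.powerset, c (insert a S) * walsh S x) ^ 2) ^ 2 := by
      cases d with
      | zero =>
        have h0 : ∀ S, c (insert a S) = 0 := fun S => hc _ (card_pos.mpr (insert_nonempty a S))
        simp [h0]
      | succ d =>
        have hz : ∀ x : ι → Bool, ∑ S ∈ A.powerset, c (insert a S) * walsh S x =
            ∑ S ∈ A.powerset, (if a ∈ S then 0 else c (insert a S)) * walsh S x := fun x =>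
          sum_congr rfl fun S hS => by rw [if_neg fun h => ha (mem_powerset.mp hS h)]
        have := ih d (fun S => if a ∈ S then 0 else c (insert a S)) fun S hS => by
          split_ifs with h
          · rfl
          · exact hc _ (by rw [card_insert_of_notMem h]; omega)
        simp only [hz]
        rw [pow_succ]
        linarith
    simp only [← pow_mul, Nat.reduceMul] at hcs
    set N : ℝ := 2 ^ Fintype.card ι
    set D : ℝ := 9 ^ d
    set p := ∑ x : ι → Bool, (∑ S ∈ A.powerset, c S * walsh S x) ^ 2
    set q := ∑ x : ι → Bool, (∑ S ∈ A.powerset, c (insert a S) * walsh S x) ^ 2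
    set P := ∑ x : ι → Bool, (∑ S ∈ A.powerset, c S * walsh S x) ^ 4
    set Q := ∑ x : ι → Bool, (∑ S ∈ A.powerset, c (insert a S) * walsh S x) ^ 4
    set R := ∑ x : ι → Bool, (∑ S ∈ A.powerset, c S * walsh S x) ^ 2 *
      (∑ S ∈ A.powerset, c (insert a S) * walsh S x) ^ 2
    have hN : 0 < N := by positivity
    have hD : 0 < D := by positivity
    have hp : 0 ≤ p := sum_nonneg fun _ _ => by positivity
    have hq : 0 ≤ q := sum_nonneg fun _ _ => by positivity
    have hP : 0 ≤ P := sum_nonneg fun _ _ => by positivity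
    have hQ : 0 ≤ Q := sum_nonneg fun _ _ => by positivity
    have hR : 3 * (N * R) ≤ D * (p * q) := by
      refine le_of_sq_le_sq ?_ (by positivity)
      calc (3 * (N * R)) ^ 2 = 9 * N ^ 2 * R ^ 2 := by ring
        _ ≤ 9 * N ^ 2 * (P * Q) := by gcongr
        _ = (N * P) * (9 * (N * Q)) := by ring
        _ ≤ (D * p ^ 2) * (D * q ^ 2) := by gcongr
        _ = (D * (p * q)) ^ 2 := by ring
    have hQ' : 0 ≤ N * Q := by positivity
    nlinarith

/-- Comparison of the second and first moments of Walsh polynomials of degree at most `d`. -/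
theorem sum_walsh_sq_le_sum_abs_sq (A : Finset ι) (d : ℕ) (c : Finset ι → ℝ)
    (hc : ∀ S, d < S.card → c S = 0) :
    2 ^ Fintype.card ι * ∑ x : ι → Bool, (∑ S ∈ A.powerset, c S * walsh S x) ^ 2 ≤
      9 ^ d * (∑ x : ι → Bool, |∑ S ∈ A.powerset, c S * walsh S x|) ^ 2 := by
  have hb := bonami A d c hc
  set g : (ι → Bool) → ℝ := fun x => ∑ S ∈ A.powerset, c S * walsh S x
  change 2 ^ Fintype.card ι * ∑ x, g x ^ 2 ≤ 9 ^ d * (∑ x, |g x|) ^ 2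
  change 2 ^ Fintype.card ι * ∑ x, g x ^ 4 ≤ 9 ^ d * (∑ x, g x ^ 2) ^ 2 at hb
  have h3 : (∑ x, g x ^ 2) ^ 2 ≤ (∑ x, |g x|) * ∑ x, |g x| ^ 3 := by
    refine sum_sq_le_sum_mul_sum_of_sq_le_mul _ (fun x _ => abs_nonneg _)
      (fun x _ => by positivity) fun x _ => le_of_eq ?_
    rw [← sq_abs (g x)]
    ring
  have h4 : (∑ x, |g x| ^ 3) ^ 2 ≤ (∑ x, g x ^ 2) * ∑ x, g x ^ 4 := by
    refine sum_sq_le_sum_mul_sum_of_sq_le_mul _ (fun x _ => by positivity)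
      (fun x _ => by positivity) fun x _ => le_of_eq ?_
    rw [← pow_mul, mul_comm 3 2, pow_mul, sq_abs]
    ring
  have h2 : 0 ≤ ∑ x, g x ^ 2 := sum_nonneg fun _ _ => by positivity
  have hN : (0 : ℝ) < 2 ^ Fintype.card ι := by positivity
  set N : ℝ := 2 ^ Fintype.card ι
  set D : ℝ := 9 ^ d
  set p := ∑ x, g x ^ 2
  set u := ∑ x, |g x|
  set v := ∑ x, |g x| ^ 3
  set P := ∑ x, g x ^ 4
  have hD : 0 < D := by positivity
  rcases h2.eq_or_lt with h | h
  · rw [← h, mul_zero]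
    positivity
  · refine le_of_mul_le_mul_right ?_ (pow_pos h 3)
    calc N * p * p ^ 3 = N * (p ^ 2) ^ 2 := by ring
      _ ≤ N * (u * v) ^ 2 := by gcongr
      _ = N * u ^ 2 * v ^ 2 := by ring
      _ ≤ N * u ^ 2 * (p * P) := by gcongr
      _ = u ^ 2 * p * (N * P) := by ring
      _ ≤ u ^ 2 * p * (D * p ^ 2) := by gcongr
      _ = D * u ^ 2 * p ^ 3 := by ring

/-- Averaging a Walsh function over the product measure with mean vector `y`. -/
theorem sum_weight_mul_walsh (y : ι → ℝ) (S : Finset ι) :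
    ∑ z : ι → Bool, (∏ j, (1 + y j * (if z j then (1 : ℝ) else -1)) / 2) * walsh S z =
      ∏ j ∈ S, y j := by
  have h := Finset.prod_univ_sum (fun _ : ι => (univ : Finset Bool))
    (fun j b => (1 + y j * (if b then (1 : ℝ) else -1)) / 2 *
      (if j ∈ S then (if b then (1 : ℝ) else -1) else 1))
  rw [Fintype.piFinset_univ] at h
  have hl : ∀ z : ι → Bool, (∏ j, (1 + y j * (if z j then (1 : ℝ) else -1)) / 2) * walsh S z =
      ∏ j, ((1 + y j * (if z j then (1 : ℝ) else -1)) / 2 *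
        (if j ∈ S then (if z j then (1 : ℝ) else -1) else 1)) := by
    intro z
    rw [prod_mul_distrib, walsh, ← prod_filter, filter_mem_eq_inter, univ_inter]
  simp only [hl, ← h]
  rw [← univ_inter S, ← filter_mem_eq_inter, prod_filter]
  refine prod_congr rfl fun j _ => ?_
  rw [Fintype.sum_bool]
  split_ifs <;> simp_all <;> ring

/-- The multilinear extension of a function bounded by `1` on the cube is bounded by `1` on the
solid cube. -/
theorem abs_multilinear_le_one (c : Finset ι → ℝ)
    (hf : ∀ x : ι → Bool, |∑ S : Finset ι, c S * walsh S x| ≤ 1) (y : ι → ℝ)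
    (hy : ∀ j, |y j| ≤ 1) : |∑ S : Finset ι, c S * ∏ j ∈ S, y j| ≤ 1 := by
  set w : (ι → Bool) → ℝ := fun z => ∏ j, (1 + y j * (if z j then (1 : ℝ) else -1)) / 2
  have hw : ∀ z, 0 ≤ w z := fun z => prod_nonneg fun j _ => by
    have := abs_le.mp (hy j)
    split_ifs <;> linarith
  have hw1 : ∑ z, w z = 1 := by
    simpa only [walsh, prod_empty, mul_one] using sum_weight_mul_walsh y ∅
  have heq : ∑ S : Finset ι, c S * ∏ j ∈ S, y j =
      ∑ z, w z * ∑ S : Finset ι, c S * walsh S z := by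
    simp only [mul_sum]
    rw [sum_comm]
    refine sum_congr rfl fun S _ => ?_
    rw [← sum_weight_mul_walsh y S, mul_sum]
    exact sum_congr rfl fun z _ => mul_left_comm _ _ _
  rw [heq]
  calc |∑ z, w z * ∑ S : Finset ι, c S * walsh S z|
      ≤ ∑ z, |w z * ∑ S : Finset ι, c S * walsh S z| := abs_sum_le_sum_abs _ _
    _ ≤ ∑ z, w z := sum_le_sum fun z _ => by
        rw [abs_mul, abs_of_nonneg (hw z)]
        exact mul_le_of_le_one_right (hw z) (hf z)
    _ = 1 := hw1

end WalshFunctions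

open Polynomial in
/-- A qualitative Markov inequality at the endpoint `1`. -/
theorem exists_bound_derivative_eval_one (d : ℕ) :
    ∃ M : ℝ, 1 ≤ M ∧ ∀ p : ℝ[X], p.natDegree ≤ d →
      (∀ t ∈ Set.Icc (0 : ℝ) 1, |p.eval t| ≤ 1) → |p.derivative.eval 1| ≤ M := by
  set v : ℕ → ℝ := fun i => i / (d + 1)
  have hv : Set.InjOn v (range (d + 1)) := by
    intro i _ j _ hij
    have hd : (d : ℝ) + 1 ≠ 0 := by positivity
    simpa [v, div_left_inj' hd] using hij
  refine ⟨1 + ∑ i ∈ range (d + 1), |(Lagrange.basis (range (d + 1)) v i).derivative.eval 1|,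
    le_add_of_nonneg_right (sum_nonneg fun _ _ => abs_nonneg _), fun p hp hb => ?_⟩
  have hdeg : p.degree < (range (d + 1)).card := by
    rw [card_range]
    exact lt_of_le_of_lt (natDegree_le_iff_degree_le.mp hp) (by exact_mod_cast Nat.lt_succ_self d)
  rw [Lagrange.eq_interpolate hv hdeg, Lagrange.interpolate_apply, derivative_sum,
    eval_finsetSum]
  refine (abs_sum_le_sum_abs _ _).trans (le_add_of_nonneg_of_le zero_le_one
    (sum_le_sum fun i hi => ?_))
  rw [derivative_C_mul, eval_C_mul, abs_mul]
  refine mul_le_of_le_one_left (abs_nonneg _) (hb _ ⟨by positivity, ?_⟩)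
  have : (i : ℝ) < d + 1 := by exact_mod_cast mem_range.mp hi
  exact (div_le_one (by positivity)).mpr this.le

section Influences

variable {ι : Type*} [DecidableEq ι] [Fintype ι]

open Polynomial in
/-- Along any set `T` of coordinates, the directional derivative at a vertex of a bounded function
of degree at most `d` is bounded by the constant of the Markov inequality. -/
theorem abs_sum_card_inter_le {d : ℕ} {M : ℝ}
    (hM : ∀ p : ℝ[X], p.natDegree ≤ d →
      (∀ t ∈ Set.Icc (0 : ℝ) 1, |p.eval t| ≤ 1) → |p.derivative.eval 1| ≤ M)
    (c : Finset ι → ℝ) (hc : ∀ S, d < S.card → c S = 0)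
    (hf : ∀ x : ι → Bool, |∑ S : Finset ι, c S * walsh S x| ≤ 1) (x : ι → Bool) (T : Finset ι) :
    |∑ S : Finset ι, c S * walsh S x * ((S ∩ T).card : ℝ)| ≤ M := by
  have h := hM (∑ S : Finset ι, C (c S * walsh S x) * X ^ (S ∩ T).card) ?_ ?_
  · simpa only [derivative_sum, eval_finsetSum, derivative_C_mul_X_pow, eval_C_mul, eval_pow,
      eval_X, one_pow, mul_one, eval_mul, eval_C] using h
  · refine natDegree_sum_le_of_forall_le _ _ fun S _ => ?_
    rcases le_or_gt S.card d with hS | hS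
    · exact (natDegree_C_mul_X_pow_le _ _).trans ((card_le_card inter_subset_left).trans hS)
    · simp [hc S hS]
  · intro t ht
    have hb := abs_multilinear_le_one c hf
      (fun j => (if x j then (1 : ℝ) else -1) * (if j ∈ T then t else 1)) fun j => by
        rw [abs_mul]
        have ht' : |t| ≤ 1 := abs_le.mpr ⟨by linarith [ht.1], ht.2⟩
        split_ifs <;> simp [ht']
    convert hb using 2
    rw [eval_finsetSum]
    refine sum_congr rfl fun S _ => ?_
    rw [prod_mul_distrib, ← prod_filter, filter_mem_eq_inter, prod_const]
    rw [eval_C_mul, eval_pow, eval_X, walsh, mul_assoc]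

/-- The sum of the absolute values of the discrete derivatives of a bounded function of degree at
most `d` is pointwise bounded. -/
theorem sum_abs_derivative_le {d : ℕ} {M : ℝ}
    (hM : ∀ p : Polynomial ℝ, p.natDegree ≤ d →
      (∀ t ∈ Set.Icc (0 : ℝ) 1, |p.eval t| ≤ 1) → |p.derivative.eval 1| ≤ M)
    (c : Finset ι → ℝ) (hc : ∀ S, d < S.card → c S = 0)
    (hf : ∀ x : ι → Bool, |∑ S : Finset ι, c S * walsh S x| ≤ 1) (x : ι → Bool) :
    ∑ i, |∑ S : Finset ι, (if i ∈ S then c S else 0) * walsh S x| ≤ 2 * M := by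
  set L : ι → ℝ := fun i => ∑ S : Finset ι, (if i ∈ S then c S else 0) * walsh S x
  have hT : ∀ T : Finset ι, |∑ i ∈ T, L i| ≤ M := by
    intro T
    convert abs_sum_card_inter_le hM c hc hf x T using 2
    rw [sum_comm]
    refine sum_congr rfl fun S _ => ?_
    rw [← sum_mul, ← sum_filter, sum_const, filter_mem_eq_inter, inter_comm, nsmul_eq_mul]
    ring
  have hpos := hT (univ.filter fun i => 0 ≤ L i)
  have hneg := hT (univ.filter fun i => ¬ 0 ≤ L i)
  change ∑ i, |L i| ≤ 2 * M
  rw [← sum_filter_add_sum_filter_not univ (fun i => 0 ≤ L i)]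
  have h1 : ∑ i ∈ univ.filter (fun i => 0 ≤ L i), |L i| =
      ∑ i ∈ univ.filter (fun i => 0 ≤ L i), L i :=
    sum_congr rfl fun i hi => abs_of_nonneg (mem_filter.mp hi).2
  have h2 : ∑ i ∈ univ.filter (fun i => ¬ 0 ≤ L i), |L i| =
      -∑ i ∈ univ.filter (fun i => ¬ 0 ≤ L i), L i := by
    rw [← sum_neg_distrib]
    exact sum_congr rfl fun i hi => abs_of_neg (not_le.mp (mem_filter.mp hi).2)
  rw [h1, h2]
  linarith [abs_le.mp hpos, abs_le.mp hneg]

/-- If the discrete derivatives are summable in mean with total `K`, then restricting the Walsh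
expansion to the coordinates whose derivative has mean at least `τ` costs at most `9 ^ d * K * τ`
in squared `L²`-norm. -/
theorem sum_sq_sub_truncation_le (d : ℕ) {K τ : ℝ}
    (c : Finset ι → ℝ) (hc : ∀ S, d < S.card → c S = 0)
    (hK : ∀ x : ι → Bool, ∑ i, |∑ S : Finset ι, (if i ∈ S then c S else 0) * walsh S x| ≤ K)
    (hτ : 0 < τ) :
    ∃ J : Finset ι, J.card * τ ≤ K ∧
      (∑ x : ι → Bool, (∑ S : Finset ι, c S * walsh S x - ∑ S ∈ J.powerset, c S * walsh S x) ^ 2) /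
        2 ^ Fintype.card ι ≤ 9 ^ d * K * τ := by
  set N : ℝ := 2 ^ Fintype.card ι with hNdef
  have hN : 0 < N := by positivity
  set ℓ : ι → ℝ := fun i =>
    (∑ x : ι → Bool, |∑ S : Finset ι, (if i ∈ S then c S else 0) * walsh S x|) / N
  have hℓ0 : ∀ i, 0 ≤ ℓ i := fun i => div_nonneg (sum_nonneg fun _ _ => abs_nonneg _) hN.le
  have hℓ : ∑ i, ℓ i ≤ K := by
    rw [← sum_div, sum_comm, div_le_iff₀ hN]
    refine (sum_le_sum fun x _ => hK x).trans ?_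
    simp [hNdef, mul_comm]
  have hinf : ∀ i, ∑ S : Finset ι, (if i ∈ S then c S ^ 2 else 0) ≤ 9 ^ d * ℓ i ^ 2 := by
    intro i
    have hi := sum_walsh_sq_le_sum_abs_sq univ d (fun S => if i ∈ S then c S else 0)
      fun S hS => by simp [hc S hS]
    rw [sum_walsh_sq, powerset_univ] at hi
    have hE : ∑ x : ι → Bool, |∑ S : Finset ι, (if i ∈ S then c S else 0) * walsh S x| =
        N * ℓ i := (mul_div_cancel₀ _ hN.ne').symm
    rw [hE, ← hNdef] at hi
    simp only [ite_pow, ne_eq, OfNat.ofNat_ne_zero, not_false_eq_true, zero_pow] at hi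
    refine le_of_mul_le_mul_left ?_ (pow_pos hN 2)
    linarith
  set J : Finset ι := univ.filter fun i => τ ≤ ℓ i
  refine ⟨J, ?_, ?_⟩
  · calc J.card * τ = ∑ i ∈ J, τ := by simp
      _ ≤ ∑ i ∈ J, ℓ i := sum_le_sum fun i hi => (mem_filter.mp hi).2
      _ ≤ ∑ i, ℓ i := sum_le_sum_of_subset_of_nonneg (subset_univ _) fun i _ _ => hℓ0 i
      _ ≤ K := hℓ
  · have hdiff : ∀ x : ι → Bool,
        ∑ S : Finset ι, c S * walsh S x - ∑ S ∈ J.powerset, c S * walsh S x =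
          ∑ S ∈ (univ : Finset ι).powerset, (if S ⊆ J then 0 else c S) * walsh S x := by
      intro x
      have hJ : J.powerset = univ.filter fun S => S ⊆ J := by
        ext S
        simp
      rw [hJ, sum_filter, ← sum_sub_distrib, powerset_univ]
      refine sum_congr rfl fun S _ => ?_
      split_ifs <;> ring
    simp only [hdiff]
    rw [sum_walsh_sq, mul_div_cancel_left₀ _ hN.ne', powerset_univ]
    calc ∑ S : Finset ι, (if S ⊆ J then 0 else c S) ^ 2
        ≤ ∑ S : Finset ι, ∑ i ∈ Jᶜ, (if i ∈ S then c S ^ 2 else 0) := by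
          refine sum_le_sum fun S _ => ?_
          have h0 : ∀ i ∈ Jᶜ, 0 ≤ if i ∈ S then c S ^ 2 else 0 := fun i _ => by
            split_ifs <;> positivity
          split_ifs with hS
          · simpa using sum_nonneg h0
          · obtain ⟨i, hiS, hiJ⟩ := not_subset.mp hS
            simpa [hiS] using single_le_sum h0 (mem_compl.mpr hiJ)
      _ = ∑ i ∈ Jᶜ, ∑ S : Finset ι, (if i ∈ S then c S ^ 2 else 0) := sum_comm
      _ ≤ ∑ i ∈ Jᶜ, 9 ^ d * τ * ℓ i := by
          refine sum_le_sum fun i hi => (hinf i).trans ?_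
          have hlt : ℓ i < τ := by simpa [J] using hi
          have : ℓ i ^ 2 ≤ τ * ℓ i := by nlinarith [hℓ0 i]
          rw [mul_assoc]
          gcongr
      _ ≤ ∑ i, 9 ^ d * τ * ℓ i := sum_le_sum_of_subset_of_nonneg (subset_univ _) fun i _ _ =>
          mul_nonneg (by positivity) (hℓ0 i)
      _ = 9 ^ d * τ * ∑ i, ℓ i := (mul_sum _ _ _).symm
      _ ≤ 9 ^ d * τ * K := by gcongr
      _ = 9 ^ d * K * τ := by ring

end Influences

/-- Low-degree bounded functions are close to juntas: for each `d ≥ 1` there is `C(d) > 0`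
such that every `f : {-1,1}ⁿ → [-1,1]` of degree at most `d` is `ε`-close in `L²` to a
`k`-junta `g` with `k ≤ d · C(d)^{2d} / ε^{2d}`. -/
theorem stmt2 (d : ℕ) (hd : 1 ≤ d) :
    ∃ C : ℝ, 0 < C ∧ ∀ n : ℕ, 1 ≤ n →
      ∀ f : (Fin n → Bool) → ℝ, ∀ fhat : Finset (Fin n) → ℝ,
        (∀ x, f x = ∑ S : Finset (Fin n),
          fhat S * ∏ j ∈ S, (if x j then (1 : ℝ) else -1)) →
        (∀ S : Finset (Fin n), d < S.card → fhat S = 0) →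
        (∀ x, f x ∈ Set.Icc (-1 : ℝ) 1) →
        ∀ ε : ℝ, 0 < ε →
          ∃ (k : ℕ) (g : (Fin n → Bool) → ℝ) (J : Finset (Fin n)),
            J.card ≤ k ∧
            (∀ x y : Fin n → Bool, (∀ j ∈ J, x j = y j) → g x = g y) ∧
            Real.sqrt ((∑ x : Fin n → Bool, (f x - g x) ^ 2) / 2 ^ n) ≤ ε ∧
            (k : ℝ) ≤ d * C ^ (2 * d) / ε ^ (2 * d) := by
  obtain ⟨M, hM1, hM⟩ := exists_bound_derivative_eval_one d
  have h3 : (1 : ℝ) ≤ 3 ^ d := one_le_pow₀ (by norm_num)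
  have hC : 1 ≤ 2 * M * 3 ^ d := by nlinarith
  refine ⟨2 * M * 3 ^ d, by positivity, fun n _ f fhat hf hdeg hb ε hε => ?_⟩
  have hd' : (1 : ℝ) ≤ d := by exact_mod_cast hd
  rcases le_or_gt 1 ε with h1 | h1
  · refine ⟨0, 0, ∅, le_rfl, fun _ _ _ => rfl, ?_, by rw [Nat.cast_zero]; positivity⟩
    refine (Real.sqrt_le_one.mpr ?_).trans h1
    rw [div_le_one (by positivity)]
    calc ∑ x, (f x - (0 : (Fin n → Bool) → ℝ) x) ^ 2 ≤ ∑ _x : Fin n → Bool, (1 : ℝ) :=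
          sum_le_sum fun x _ => by
            rw [Pi.zero_apply, sub_zero, sq_le_one_iff_abs_le_one]
            exact abs_le.mpr (hb x)
      _ = 2 ^ n := by simp
  · have hf' : ∀ x, f x = ∑ S : Finset (Fin n), fhat S * walsh S x := hf
    have hK := sum_abs_derivative_le hM fhat hdeg fun x => by
      rw [← hf' x]
      exact abs_le.mpr (hb x)
    have hτ : 0 < ε ^ 2 / (9 ^ d * (2 * M)) := by positivity
    obtain ⟨J, hJ, hJ2⟩ := sum_sq_sub_truncation_le d fhat hdeg hK hτ
    refine ⟨J.card, fun x => ∑ S ∈ J.powerset, fhat S * walsh S x, J, le_rfl, ?_, ?_, ?_⟩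
    · intro x y hxy
      refine sum_congr rfl fun S hS => ?_
      congr 1
      exact prod_congr rfl fun j hj => by rw [hxy j (mem_powerset.mp hS hj)]
    · rw [mul_div_cancel₀ _ (by positivity), Fintype.card_fin] at hJ2
      simp only [hf']
      exact Real.sqrt_le_iff.mpr ⟨hε.le, hJ2⟩
    · have h9 : (9 : ℝ) ^ d = (3 ^ d) ^ 2 := by
        rw [← pow_mul, mul_comm, pow_mul]
        norm_num
      have hcard : (J.card : ℝ) ≤ (2 * M * 3 ^ d) ^ 2 / ε ^ 2 := by
        rw [mul_div_assoc', div_le_iff₀ (by positivity), h9] at hJ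
        rw [le_div_iff₀ (by positivity)]
        linarith
      refine hcard.trans (div_le_div₀ (by positivity) ?_ (by positivity) ?_)
      · calc (2 * M * 3 ^ d) ^ 2 ≤ (2 * M * 3 ^ d) ^ (2 * d) :=
              pow_le_pow_right₀ hC (by omega)
          _ ≤ d * (2 * M * 3 ^ d) ^ (2 * d) := le_mul_of_one_le_left (by positivity) hd'
      · exact pow_le_pow_of_le_one hε.le h1.le (by omega)
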